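/- Let (v̄₁, v̄₂), where v̄_i = (v₀^i, v₁^i, ..., v_k^i) for i = 1,2, be a critical pair of separating walks in G_d (d ≥ 3). Then (v̄'₁, v̄'₂), where v̄'_i = (v₀^i, v₁^i, ..., v_{k−2}^i) for i = 1,2, is a pair of separating walks in G_{d−1}. -/

import Mathlib

namespace Paper

/-- Nodes of the tree `G_d` are finite sequences of pairs of numbers.
We represent a sequence `(a₁, …, a_i)` as the list `[a_i, …, a₁]`, i.e. in
reverse order, so that consing corresponds to appending a pair at the end. -/
abbrev Nd : Type := ℕ × ℕ

/-- `b₂⁺`: `1` if `b₂ = 0`, and `b₂` otherwise. -/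
def bplus (b : ℕ) : ℕ := if b = 0 then 1 else b

/-- For `j ≥ 1`, the `j`-th smallest element of `{lo, lo+1, lo+2, …} \ {f}`.
This realises the greedy choices `c^j = min({lo,…} \ {f, c¹, …, c^{j-1}})`. -/
def nthAvoid (lo f j : ℕ) : ℕ :=
  if lo + j - 1 < f ∨ f < lo then lo + j - 1 else lo + j

/-- The node set `V_d` of the graph `G_d`, given by the rules (G1)–(G4).
(Sequences are represented as reversed lists, the head being the last pair
`a_i` of the sequence.) -/
inductive Vd (d : ℕ) : List Nd → Prop
  /-- (G1): the empty sequence is a node. -/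
  | nil : Vd d []
  /-- (G2): the sequences `((1,0)), ((2,1)), …, ((d,d−1))` are nodes. -/
  | base (k : ℕ) (h1 : 1 ≤ k) (h2 : k ≤ d) : Vd d [(k, k - 1)]
  /-- (G3): children of a node of odd length `< 2d` with last pair `(b₁, b₂)`:
  for `j = 1, …, d−1` append `(c₁ʲ, c₂ʲ)` where `c₁ʲ` is the `j`-th smallest
  element of `{1,…,d} \ {b₂⁺}` and `c₂ʲ` the `j`-th smallest of `{1,…,d} \ {b₁}`. -/
  | odd (b₁ b₂ : ℕ) (rest : List Nd)
      (hv : Vd d ((b₁, b₂) :: rest))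
      (hodd : Odd ((b₁, b₂) :: rest).length)
      (hlt : ((b₁, b₂) :: rest).length < 2 * d)
      (j : ℕ) (hj1 : 1 ≤ j) (hj2 : j ≤ d - 1) :
      Vd d ((nthAvoid 1 (bplus b₂) j, nthAvoid 1 b₁ j) :: (b₁, b₂) :: rest)
  /-- (G4): children of a node of even positive length `< 2d` with last pair
  `(b₁, b₂)`: for `j = 1, …, d−1` append `(c₁ʲ, c₂ʲ)` where `c₁ʲ` is the `j`-th
  smallest element of `{1,…,d} \ {b₂}` and `c₂ʲ` the `j`-th smallest of
  `{0,…,d−1} \ {b₁}`. -/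
  | even (b₁ b₂ : ℕ) (rest : List Nd)
      (hv : Vd d ((b₁, b₂) :: rest))
      (heven : Even ((b₁, b₂) :: rest).length)
      (hlt : ((b₁, b₂) :: rest).length < 2 * d)
      (j : ℕ) (hj1 : 1 ≤ j) (hj2 : j ≤ d - 1) :
      Vd d ((nthAvoid 1 b₂ j, nthAvoid 0 b₁ j) :: (b₁, b₂) :: rest)

/-- The edge relation of `G_d`: `u` is a child of `v` or vice versa. -/
def Ed (d : ℕ) (v u : List Nd) : Prop :=
  Vd d v ∧ Vd d u ∧ ∃ a : Nd, u = a :: v ∨ v = a :: u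

/-- The outgoing port number `π_d(v, u)` from `v` towards an adjacent node `u`:
if `u = (b₁, b₂) :: v` is a child of `v` then `b₁`, and if `v = (b₁, b₂) :: u`
is a child of `u` then `b₂`. -/
def outPort (v u : List Nd) : ℕ :=
  if u.length = v.length + 1 then u.headI.1 else v.headI.2

/-- A pair of compatible walks (PCW) of length `k` in `G_d`:
two walks starting at `((1,0))` and `((2,1))` such that the outgoing port
numbers backwards along the walks coincide. -/
structure IsPCW (d k : ℕ) (w₁ w₂ : ℕ → List Nd) : Prop where
  klen : k ≤ 2 * d - 3
  walk₁ : ∀ j < k, Ed d (w₁ j) (w₁ (j + 1))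
  walk₂ : ∀ j < k, Ed d (w₂ j) (w₂ (j + 1))
  start₁ : w₁ 0 = [(1, 0)]
  start₂ : w₂ 0 = [(2, 1)]
  compat : ∀ j, 1 ≤ j → j ≤ k →
    outPort (w₁ j) (w₁ (j - 1)) = outPort (w₂ j) (w₂ (j - 1))

/-- A pair of separating walks (PSW): a PCW such that the last node of the
first walk has a neighbour whose outgoing port number towards it is matched
by no neighbour of the last node of the second walk. -/
structure IsPSW (d k : ℕ) (w₁ w₂ : ℕ → List Nd)
    extends IsPCW d k w₁ w₂ : Prop where
  sep : ∃ x, Ed d (w₁ k) x ∧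
    ∀ y, Ed d (w₂ k) y → outPort x (w₁ k) ≠ outPort y (w₂ k)

/-- A PSW of length `k` in `G_d` is critical if there is no strictly shorter
PSW in `G_d`. -/
def IsCriticalPSW (d k : ℕ) (w₁ w₂ : ℕ → List Nd) : Prop :=
  IsPSW d k w₁ w₂ ∧ ∀ k' w₁' w₂', IsPSW d k' w₁' w₂' → k ≤ k'

def Lab (n : ℕ) : List Nd → Prop
  | [] => True
  | a :: l => Lab n l ∧ 1 ≤ a.1 ∧ a.1 ≤ n ∧ a.2 ≤ n ∧ (l.length % 2 = 0 → a.2 < n) ∧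
    (l.length % 2 = 1 → 1 ≤ a.2)

theorem Lab.mono {n m : ℕ} (h : n ≤ m) : ∀ {x : List Nd}, Lab n x → Lab m x
  | [], _ => trivial
  | _ :: _, ⟨h1, h2, h3, h4, h5, h6⟩ =>
    ⟨Lab.mono h h1, h2, by omega, by omega, fun e => by have := h5 e; omega, h6⟩

theorem Vd.lab {d : ℕ} (hd : 2 ≤ d) {x : List Nd} (h : Vd d x) : Lab d x := by
  induction h with
  | nil => trivial
  | base k h1 h2 => exact ⟨trivial, h1, h2, by simp; omega, fun _ => by simp; omega, by simp⟩
  | odd b₁ b₂ rest hv hodd hlt j hj1 hj2 ih =>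
    refine ⟨ih, ?_⟩
    rw [Nat.odd_iff] at hodd
    simp only [List.length_cons, nthAvoid] at *
    refine ⟨by split_ifs <;> omega, by split_ifs <;> omega, by split_ifs <;> omega, fun h => by omega,
      fun _ => by split_ifs <;> omega⟩
  | even b₁ b₂ rest hv heven hlt j hj1 hj2 ih =>
    refine ⟨ih, ?_⟩
    rw [Nat.even_iff] at heven
    obtain ⟨_, h1, h2, h3, _, _⟩ := ih
    simp only [List.length_cons, nthAvoid] at *
    refine ⟨by split_ifs <;> omega, by split_ifs <;> omega, by split_ifs <;> omega, fun h => ?_, fun h => by omega⟩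
    split_ifs <;> omega

theorem Vd.of_lab {d n : ℕ} (hn : 2 ≤ n) {x : List Nd} (h : Vd d x) :
    Lab n x → x.length ≤ 2 * n → Vd n x := by
  induction h with
  | nil => exact fun _ _ => .nil
  | base k h1 h2 => exact fun hl _ => .base k h1 hl.2.2.1
  | odd b₁ b₂ rest hv hodd hlt j hj1 hj2 ih =>
    intro hl hlen
    rw [List.length_cons] at hlen
    refine .odd b₁ b₂ rest (ih hl.1 (by omega)) hodd (by omega) j hj1 ?_
    obtain ⟨⟨_, h1, h2, h3, h4, h4'⟩, h5, h6, h7, _⟩ := hl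
    rw [Nat.odd_iff] at hodd
    simp only [List.length_cons, nthAvoid, bplus] at *
    have := h4 (by omega)
    split_ifs at h6 <;> omega
  | even b₁ b₂ rest hv heven hlt j hj1 hj2 ih =>
    intro hl hlen
    rw [List.length_cons] at hlen
    refine .even b₁ b₂ rest (ih hl.1 (by omega)) heven (by omega) j hj1 ?_
    obtain ⟨⟨_, h1, h2, h3, h4, h4'⟩, h5, h6, h7, _⟩ := hl
    rw [Nat.even_iff] at heven
    simp only [List.length_cons, nthAvoid] at *
    have := h4' (by omega)
    split_ifs at h6 <;> omega

theorem outPort_child (a : Nd) (v : List Nd) : outPort (a :: v) v = a.2 := by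
  simp [outPort]
  intro h; omega

theorem outPort_parent (a : Nd) (v : List Nd) : outPort v (a :: v) = a.1 := by
  simp [outPort]

theorem Ed.root {d : ℕ} {y : List Nd} (h : Ed d [] y) :
    y = [(outPort y [] + 1, outPort y [])] ∧ outPort y [] < d := by
  obtain ⟨_, hy, a, h | h⟩ := h
  · subst h
    rw [outPort_child]
    cases hy with
    | base k h1 h2 => simp; omega
  · cases h

theorem Ed.odd {d : ℕ} (hd : 2 ≤ d) {b₁ b₂ : ℕ} {r y : List Nd} (h : Ed d ((b₁, b₂) :: r) y)
    (ho : r.length % 2 = 0) :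
    (outPort y ((b₁, b₂) :: r) = b₁ ∧ y = r) ∨
    (outPort y ((b₁, b₂) :: r) ≠ b₁ ∧ 1 ≤ outPort y ((b₁, b₂) :: r) ∧
      outPort y ((b₁, b₂) :: r) ≤ d ∧
      y = (nthAvoid 1 (bplus b₂) (if outPort y ((b₁, b₂) :: r) < b₁ then
        outPort y ((b₁, b₂) :: r) else outPort y ((b₁, b₂) :: r) - 1),
        outPort y ((b₁, b₂) :: r)) :: (b₁, b₂) :: r) := by
  obtain ⟨hx, hy, a, h | h⟩ := h
  · right
    subst h
    rw [outPort_child]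
    have hl := hx.lab hd
    obtain ⟨_, h1, h2, h3, h4, h4'⟩ := hl
    simp only at h1 h2 h3 h4
    cases hy with
    | odd b₁ b₂ rest hv hodd hlt j hj1 hj2 =>
      have e : j = if nthAvoid 1 b₁ j < b₁ then nthAvoid 1 b₁ j else nthAvoid 1 b₁ j - 1 := by
        simp only [nthAvoid]; split_ifs <;> omega
      refine ⟨?_, ?_, ?_, ?_⟩
      · simp only [nthAvoid]; split_ifs <;> omega
      · simp only [nthAvoid]; split_ifs <;> omega
      · simp only [nthAvoid]; split_ifs <;> omega
      · simp only; rw [← e]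
    | even b₁ b₂ rest hv heven hlt j hj1 hj2 =>
      rw [Nat.even_iff, List.length_cons] at heven; omega
  · left
    obtain ⟨rfl, rfl⟩ := List.cons.inj h
    exact ⟨outPort_parent _ _, rfl⟩

theorem Ed.even {d : ℕ} (hd : 2 ≤ d) {b₁ b₂ : ℕ} {r y : List Nd} (h : Ed d ((b₁, b₂) :: r) y)
    (ho : r.length % 2 = 1) :
    (outPort y ((b₁, b₂) :: r) = b₁ ∧ y = r) ∨
    (outPort y ((b₁, b₂) :: r) ≠ b₁ ∧
      outPort y ((b₁, b₂) :: r) < d ∧ (b₁ = d → outPort y ((b₁, b₂) :: r) ≠ d - 1) ∧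
      y = (nthAvoid 1 b₂ (if outPort y ((b₁, b₂) :: r) < b₁ then
        outPort y ((b₁, b₂) :: r) + 1 else outPort y ((b₁, b₂) :: r)),
        outPort y ((b₁, b₂) :: r)) :: (b₁, b₂) :: r) := by
  obtain ⟨hx, hy, a, h | h⟩ := h
  · right
    subst h
    rw [outPort_child]
    have hl := hx.lab hd
    obtain ⟨_, h1, h2, h3, h4, h4'⟩ := hl
    simp only at h1 h2 h3 h4
    cases hy with
    | even b₁ b₂ rest hv hodd hlt j hj1 hj2 =>
      have e : j = if nthAvoid 0 b₁ j < b₁ then nthAvoid 0 b₁ j + 1 else nthAvoid 0 b₁ j := by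
        simp only [nthAvoid]; split_ifs <;> omega
      refine ⟨?_, ?_, ?_, ?_⟩
      · simp only [nthAvoid]; split_ifs <;> omega
      · simp only [nthAvoid]; split_ifs <;> omega
      · simp only [nthAvoid]; split_ifs <;> omega
      · simp only; rw [← e]
    | odd b₁ b₂ rest hv heven hlt j hj1 hj2 =>
      rw [Nat.odd_iff, List.length_cons] at heven; omega
  · left
    obtain ⟨rfl, rfl⟩ := List.cons.inj h
    exact ⟨outPort_parent _ _, rfl⟩

def Av (d : ℕ) (v : List Nd) (p : ℕ) : Prop := ∃ y, Ed d v y ∧ outPort y v = p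

theorem Vd.tail {d : ℕ} {a : Nd} {l : List Nd} (h : Vd d (a :: l)) : Vd d l := by
  cases h with
  | base => exact .nil
  | odd b₁ b₂ rest hv => exact hv
  | even b₁ b₂ rest hv => exact hv

theorem av_odd {d : ℕ} (hd : 2 ≤ d) {v : List Nd} (hv : Vd d v) (ho : v.length % 2 = 1)
    (hl : v.length < 2 * d) (p : ℕ) : Av d v p ↔ 1 ≤ p ∧ p ≤ d := by
  obtain _ | ⟨⟨b₁, b₂⟩, r⟩ := v
  · simp at ho
  have hlab := hv.lab hd
  obtain ⟨_, h1, h2, h3, h4, h4'⟩ := hlab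
  simp only at h1 h2 h3 h4
  constructor
  · rintro ⟨y, hy, rfl⟩
    rcases hy.odd hd (by simp at ho; omega) with ⟨h, _⟩ | ⟨_, h, h', _⟩ <;> omega
  · rintro ⟨hp1, hp2⟩
    by_cases hp : p = b₁
    · exact ⟨r, ⟨hv, hv.tail, _, .inr rfl⟩, by rw [outPort_parent, hp]⟩
    · have := Vd.odd b₁ b₂ r hv (Nat.odd_iff.2 ho) hl (if p < b₁ then p else p - 1)
        (by split_ifs <;> omega) (by split_ifs <;> omega)
      refine ⟨_, ⟨hv, this, _, .inl rfl⟩, ?_⟩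
      rw [outPort_child]
      simp only [nthAvoid]; split_ifs <;> omega

theorem av_even {d : ℕ} (hd : 2 ≤ d) {v : List Nd} (hv : Vd d v) (ho : v.length % 2 = 0)
    (hl : v.length < 2 * d) (p : ℕ) :
    Av d v p ↔ p ≤ d ∧ (v.headI.1 = d → p ≠ d - 1) ∧ (v.headI.1 ≠ d → p ≠ d) := by
  obtain _ | ⟨⟨b₁, b₂⟩, r⟩ := v
  · have : (default : ℕ × ℕ).1 = 0 := rfl
    simp only [List.headI, this]
    constructor
    · rintro ⟨y, hy, rfl⟩
      have := hy.root.2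
      omega
    · intro h
      exact ⟨_, ⟨.nil, .base (p + 1) (by omega) (by omega), _, .inl rfl⟩, outPort_child _ _⟩
  have hlab := hv.lab hd
  obtain ⟨_, h1, h2, h3, h4, h4'⟩ := hlab
  simp only [List.headI] at h1 h2 h3 h4 ⊢
  constructor
  · rintro ⟨y, hy, rfl⟩
    rcases hy.even hd (by simp at ho; omega) with ⟨h, _⟩ | ⟨_, h, h', _⟩ <;> omega
  · intro hp'
    by_cases hp : p = b₁
    · exact ⟨r, ⟨hv, hv.tail, _, .inr rfl⟩, by rw [outPort_parent, hp]⟩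
    · have := Vd.even b₁ b₂ r hv (Nat.even_iff.2 ho) hl (if p < b₁ then p + 1 else p)
        (by split_ifs <;> omega) (by split_ifs <;> omega)
      refine ⟨_, ⟨hv, this, _, .inl rfl⟩, ?_⟩
      rw [outPort_child]
      simp only [nthAvoid]; split_ifs <;> omega

def Sep (d : ℕ) (v₁ v₂ : List Nd) : Prop :=
  ∃ x, Ed d v₁ x ∧ ∀ y, Ed d v₂ y → outPort x v₁ ≠ outPort y v₂

theorem sep_iff {d : ℕ} {v₁ v₂ : List Nd} : Sep d v₁ v₂ ↔ ∃ p, Av d v₁ p ∧ ¬ Av d v₂ p := by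
  constructor
  · rintro ⟨x, hx, h⟩
    exact ⟨_, ⟨x, hx, rfl⟩, fun ⟨y, hy, e⟩ => h y hy e.symm⟩
  · rintro ⟨p, ⟨x, hx, rfl⟩, h⟩
    exact ⟨x, hx, fun y hy e => h ⟨y, hy, e.symm⟩⟩

theorem sep_iff' {d : ℕ} (hd : 2 ≤ d) {v₁ v₂ : List Nd} (h₁ : Vd d v₁) (h₂ : Vd d v₂)
    (l₁ : v₁.length < 2 * d) (l₂ : v₂.length < 2 * d)
    (hp : v₁.length % 2 = v₂.length % 2) :
    Sep d v₁ v₂ ↔ v₁.length % 2 = 0 ∧ ¬ (v₁.headI.1 = d ↔ v₂.headI.1 = d) := by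
  rw [sep_iff]
  rcases Nat.mod_two_eq_zero_or_one v₁.length with e | e
  · simp only [av_even hd h₁ e l₁, av_even hd h₂ (hp ▸ e) l₂]
    constructor
    · rintro ⟨p, hp, hp'⟩
      exact ⟨e, fun h => by omega⟩
    · rintro ⟨_, h⟩
      by_cases c : v₁.headI.1 = d
      · exact ⟨d, by omega, by omega⟩
      · exact ⟨d - 1, by omega, by omega⟩
  · simp only [av_odd hd h₁ e l₁, av_odd hd h₂ (hp ▸ e) l₂]
    constructor
    · rintro ⟨p, hp, hp'⟩; exact absurd hp hp'
    · omega

theorem step_odd {d n : ℕ} (hd : 2 ≤ d) (hn : 2 ≤ n) {x y : List Nd} (hl : Lab n x)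
    (ho : x.length % 2 = 1) (h : Ed d x y) :
    (outPort y x ≤ n → Lab n y) ∧
    (n < outPort y x → y = (outPort y x, outPort y x) :: x) := by
  obtain _ | ⟨⟨b₁, b₂⟩, r⟩ := x
  · simp at ho
  have hr : r.length % 2 = 0 := by simp at ho; omega
  have hl' := hl
  obtain ⟨h0, h1, h2, h3, h4, h4'⟩ := hl'
  have h4 := h4 hr
  simp only at h1 h2 h3 h4
  rcases h.odd hd hr with ⟨hp, hy⟩ | ⟨hp, hp1, hp2, hy⟩
  · exact ⟨fun _ => hy ▸ h0, fun h => by omega⟩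
  · generalize outPort y ((b₁, b₂) :: r) = p at *
    subst hy
    constructor
    · intro hpn
      refine ⟨hl, ?_, ?_, hpn, fun h => by simp at h; omega, fun _ => hp1⟩ <;>
        simp only [nthAvoid, bplus] <;> split_ifs <;> omega
    · intro hpn
      congr 2
      simp only [nthAvoid, bplus]; split_ifs <;> omega

theorem step_even {d n : ℕ} (hd : 2 ≤ d) (hn : 2 ≤ n) {x y : List Nd} (hl : Lab n x)
    (ho : x.length % 2 = 0) (h : Ed d x y) :
    (outPort y x ≤ n → Lab (n + 1) y) ∧
    (n < outPort y x → y = (outPort y x + 1, outPort y x) :: x) ∧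
    (x.headI.1 ≠ n → (outPort y x < n → Lab n y) ∧
      (n ≤ outPort y x → y = (outPort y x + 1, outPort y x) :: x)) ∧
    (x.headI.1 = n → outPort y x ≤ n → (outPort y x + 1 ≠ n → Lab n y) ∧
      (outPort y x + 1 = n → y = (n + 1, n - 1) :: x)) := by
  obtain _ | ⟨⟨b₁, b₂⟩, r⟩ := x
  · obtain ⟨hy, hp⟩ := h.root
    generalize outPort y [] = p at *
    have : (default : ℕ × ℕ).1 = 0 := rfl
    simp only [List.headI, this]
    subst hy
    refine ⟨fun h => ?_, fun _ => rfl, fun _ => ⟨fun h => ?_, fun _ => rfl⟩, fun h => by omega⟩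
    · exact ⟨trivial, by simp, by simp; omega, by simp; omega, fun _ => by simp; omega, by simp⟩
    · exact ⟨trivial, by simp, by simp; omega, by simp; omega, fun _ => by simp; omega, by simp⟩
  have hr : r.length % 2 = 1 := by simp at ho; omega
  have hl' := hl
  obtain ⟨h0, h1, h2, h3, h4, h4'⟩ := hl'
  have h4' := h4' hr
  simp only [List.headI] at h1 h2 h3 h4 h4' ⊢
  rcases h.even hd hr with ⟨hp, hy⟩ | ⟨hp, hp1, hp2, hy⟩
  · subst hy
    exact ⟨fun _ => h0.mono (by omega), fun h => by omega,
      fun h' => ⟨fun _ => h0, fun h => by omega⟩, fun h _ => ⟨fun _ => h0, fun h => by omega⟩⟩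
  · generalize outPort y ((b₁, b₂) :: r) = p at *
    subst hy
    refine ⟨fun h => ?_, fun _ => ?_, fun h => ⟨fun h => ?_, fun h => ?_⟩, fun hh _ => ⟨fun h => ?_, fun h => ?_⟩⟩
    · refine ⟨hl.mono (by omega), ?_, ?_, by simp; omega, fun h => by simp; omega,
        fun h => by simp at h; omega⟩ <;>
        simp only [nthAvoid] <;> split_ifs <;> omega
    · congr 2
      simp only [nthAvoid]; split_ifs <;> omega
    · refine ⟨hl, ?_, ?_, by simp; omega, fun h => by simp; omega,
        fun h => by simp at h; omega⟩ <;>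
        simp only [nthAvoid] <;> split_ifs <;> omega
    · congr 2
      simp only [nthAvoid]; split_ifs <;> omega
    · refine ⟨hl, ?_, ?_, by simp; omega, fun h => by simp; omega,
        fun h => by simp at h; omega⟩ <;>
        simp only [nthAvoid] <;> split_ifs <;> omega
    · congr 2
      · simp only [nthAvoid]; split_ifs <;> omega
      · omega

theorem step_same {d : ℕ} (hd : 2 ≤ d) {a : Nd} {z₁ z₂ y₁ y₂ : List Nd}
    (hpar : z₁.length % 2 = z₂.length % 2)
    (h₁ : Ed d (a :: z₁) y₁) (h₂ : Ed d (a :: z₂) y₂)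
    (hc : outPort y₁ (a :: z₁) = outPort y₂ (a :: z₂)) :
    (y₁ = z₁ ∧ y₂ = z₂) ∨ ∃ b, y₁ = b :: a :: z₁ ∧ y₂ = b :: a :: z₂ := by
  obtain ⟨b₁, b₂⟩ := a
  rcases Nat.mod_two_eq_zero_or_one z₁.length with e | e
  · rcases h₁.odd hd e with ⟨hp, hy⟩ | ⟨hp, _, _, hy⟩ <;>
    rcases h₂.odd hd (hpar ▸ e) with ⟨hp', hy'⟩ | ⟨hp', _, _, hy'⟩
    · exact .inl ⟨hy, hy'⟩
    · omega
    · omega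
    · rw [← hc] at hy'
      exact .inr ⟨_, hy, hy'⟩
  · rcases h₁.even hd e with ⟨hp, hy⟩ | ⟨hp, _, _, hy⟩ <;>
    rcases h₂.even hd (hpar ▸ e) with ⟨hp', hy'⟩ | ⟨hp', _, _, hy'⟩
    · exact .inl ⟨hy, hy'⟩
    · omega
    · omega
    · rw [← hc] at hy'
      exact .inr ⟨_, hy, hy'⟩

theorem step_joint {d n : ℕ} (hd : 2 ≤ d) (hn : 2 ≤ n) {x₁ x₂ y₁ y₂ : List Nd}
    (l₁ : Lab n x₁) (l₂ : Lab n x₂) (hpar : x₁.length % 2 = x₂.length % 2)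
    (h₁ : Ed d x₁ y₁) (h₂ : Ed d x₂ y₂) (hc : outPort y₁ x₁ = outPort y₂ x₂) :
    (Lab (n + (1 - x₁.length % 2)) y₁ ∧ Lab (n + (1 - x₁.length % 2)) y₂) ∨
      ∃ b, y₁ = b :: x₁ ∧ y₂ = b :: x₂ := by
  rcases Nat.mod_two_eq_zero_or_one x₁.length with e | e
  · have s₁ := step_even hd hn l₁ e h₁
    have s₂ := step_even hd hn l₂ (hpar ▸ e) h₂
    rw [← hc] at s₂
    rw [e]
    by_cases hp : outPort y₁ x₁ ≤ n
    · exact .inl ⟨s₁.1 hp, s₂.1 hp⟩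
    · exact .inr ⟨_, s₁.2.1 (by omega), s₂.2.1 (by omega)⟩
  · have s₁ := step_odd hd hn l₁ e h₁
    have s₂ := step_odd hd hn l₂ (hpar ▸ e) h₂
    rw [← hc] at s₂
    rw [e]
    by_cases hp : outPort y₁ x₁ ≤ n
    · exact .inl ⟨s₁.1 hp, s₂.1 hp⟩
    · exact .inr ⟨_, s₁.2 (by omega), s₂.2 (by omega)⟩

theorem step_agree {d n : ℕ} (hd : 2 ≤ d) (hn : 2 ≤ n) {x₁ x₂ y₁ y₂ : List Nd}
    (l₁ : Lab n x₁) (l₂ : Lab n x₂) (e₁ : x₁.length % 2 = 0) (e₂ : x₂.length % 2 = 0)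
    (h₁ : Ed d x₁ y₁) (h₂ : Ed d x₂ y₂) (hc : outPort y₁ x₁ = outPort y₂ x₂)
    (ha : x₁.headI.1 = n ↔ x₂.headI.1 = n) :
    (Lab n y₁ ∧ Lab n y₂) ∨ ∃ b, y₁ = b :: x₁ ∧ y₂ = b :: x₂ := by
  obtain ⟨_, s₁, t₁, u₁⟩ := step_even hd hn l₁ e₁ h₁
  obtain ⟨_, s₂, t₂, u₂⟩ := step_even hd hn l₂ e₂ h₂
  rw [← hc] at s₂ t₂ u₂
  by_cases hp : n < outPort y₁ x₁
  · exact .inr ⟨_, s₁ hp, s₂ hp⟩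
  by_cases c : x₁.headI.1 = n
  · have c₁ := u₁ c (by omega)
    have c₂ := u₂ (ha.1 c) (by omega)
    by_cases hq : outPort y₁ x₁ + 1 = n
    · exact .inr ⟨_, c₁.2 hq, c₂.2 hq⟩
    · exact .inl ⟨c₁.1 hq, c₂.1 hq⟩
  · have c₁ := t₁ c
    have c₂ := t₂ (fun h => c (ha.2 h))
    by_cases hq : outPort y₁ x₁ < n
    · exact .inl ⟨c₁.1 hq, c₂.1 hq⟩
    · exact .inr ⟨_, c₁.2 (by omega), c₂.2 (by omega)⟩

def Late (t : ℕ) (v₁ v₂ : List Nd) : Prop :=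
  ∃ (u x₁ x₂ : List Nd) (n : ℕ), v₁ = u ++ x₁ ∧ v₂ = u ++ x₂ ∧ 2 ≤ n ∧ Lab n x₁ ∧ Lab n x₂ ∧
    x₁.length % 2 = x₂.length % 2 ∧
    (2 * n + (1 - x₁.length % 2) ≤ t + 2 ∨ (u ≠ [] ∧ 2 * n + (1 - x₁.length % 2) ≤ t + 3))

theorem Ed.len {d : ℕ} {x y : List Nd} (h : Ed d x y) :
    y.length = x.length + 1 ∨ x.length = y.length + 1 := by
  obtain ⟨_, _, a, rfl | rfl⟩ := h <;> simp

theorem Late.step {d t : ℕ} (hd : 2 ≤ d) {v₁ v₂ y₁ y₂ : List Nd} (h : Late t v₁ v₂)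
    (h₁ : Ed d v₁ y₁) (h₂ : Ed d v₂ y₂) (hc : outPort y₁ v₁ = outPort y₂ v₂) :
    Late (t + 1) y₁ y₂ := by
  obtain ⟨u, x₁, x₂, n, rfl, rfl, hn, l₁, l₂, hpar, ht⟩ := h
  obtain _ | ⟨a, u⟩ := u
  · simp only [List.nil_append, ne_eq, not_true_eq_false, false_and, or_false] at *
    rcases step_joint hd hn l₁ l₂ hpar h₁ h₂ hc with ⟨m₁, m₂⟩ | ⟨b, hb₁, hb₂⟩
    · have := h₁.len
      have := h₂.len
      exact ⟨[], y₁, y₂, _, rfl, rfl, by omega, m₁, m₂, by omega, .inl (by omega)⟩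
    · exact ⟨[b], x₁, x₂, n, hb₁, hb₂, hn, l₁, l₂, hpar, .inr ⟨by simp, by omega⟩⟩
  · rcases step_same hd (by simp; omega) h₁ h₂ hc with ⟨rfl, rfl⟩ | ⟨b, rfl, rfl⟩
    · exact ⟨u, x₁, x₂, n, rfl, rfl, hn, l₁, l₂, hpar, .inl (by omega)⟩
    · exact ⟨b :: a :: u, x₁, x₂, n, rfl, rfl, hn, l₁, l₂, hpar, .inr ⟨by simp, by omega⟩⟩

theorem headI_le {n : ℕ} {x : List Nd} (h : Lab n x) : x.headI.1 ≤ n := by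
  obtain _ | ⟨a, x⟩ := x
  · exact Nat.zero_le _
  · exact h.2.2.1

theorem Late.not_sep {d t : ℕ} (hd : 2 ≤ d) (ht : t ≤ 2 * d - 3) {v₁ v₂ : List Nd}
    (h : Late t v₁ v₂) (h₁ : Vd d v₁) (h₂ : Vd d v₂)
    (l₁ : v₁.length < 2 * d) (l₂ : v₂.length < 2 * d) : ¬ Sep d v₁ v₂ := by
  obtain ⟨u, x₁, x₂, n, rfl, rfl, hn, m₁, m₂, hpar, hb⟩ := h
  rw [sep_iff' hd h₁ h₂ l₁ l₂ (by simp; omega)]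
  rintro ⟨he, h⟩
  obtain _ | ⟨a, u⟩ := u
  · simp only [List.nil_append, ne_eq, not_true_eq_false, false_and, or_false] at *
    have := headI_le m₁
    have := headI_le m₂
    omega
  · exact h Iff.rfl

theorem PCW.len {d k : ℕ} (hd : 2 ≤ d) {w₁ w₂ : ℕ → List Nd} (h : IsPCW d k w₁ w₂) :
    ∀ j ≤ k, Vd d (w₁ j) ∧ Vd d (w₂ j) ∧ (w₁ j).length ≤ j + 1 ∧ (w₂ j).length ≤ j + 1 ∧
      (w₁ j).length % 2 = (j + 1) % 2 ∧ (w₂ j).length % 2 = (j + 1) % 2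
  | 0, _ => by
    rw [h.start₁, h.start₂]
    exact ⟨.base 1 (by omega) (by omega), .base 2 (by omega) (by omega), by simp⟩
  | j + 1, hj => by
    have ih := PCW.len hd h j (by omega)
    have e₁ := h.walk₁ j hj
    have e₂ := h.walk₂ j hj
    have := e₁.len
    have := e₂.len
    exact ⟨e₁.2.1, e₂.2.1, by omega, by omega, by omega, by omega⟩

def Tight (t : ℕ) (w₁ w₂ : ℕ → List Nd) : Prop :=
  ∀ j ≤ t, Lab (j / 2 + 2) (w₁ j) ∧ Lab (j / 2 + 2) (w₂ j)

theorem PCW.inv {d k : ℕ} (hd : 2 ≤ d) {w₁ w₂ : ℕ → List Nd} (h : IsPCW d k w₁ w₂) :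
    ∀ t ≤ k, Tight t w₁ w₂ ∨ Late t (w₁ t) (w₂ t)
  | 0, _ => by
    left
    intro j hj
    obtain rfl : j = 0 := by omega
    rw [h.start₁, h.start₂]
    simp [Lab]
  | t + 1, ht => by
    have e₁ := h.walk₁ t ht
    have e₂ := h.walk₂ t ht
    have hc := h.compat (t + 1) (by omega) ht
    simp only [Nat.add_sub_cancel] at hc
    have hL := PCW.len hd h t (by omega)
    rcases PCW.inv hd h t (by omega) with ih | ih
    · have l := ih t le_rfl
      rcases step_joint hd (by omega) l.1 l.2 (by omega) e₁ e₂ hc with ⟨m₁, m₂⟩ | ⟨b, hb₁, hb₂⟩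
      · left
        intro j hj
        rcases Nat.lt_or_ge t j with c | c
        · obtain rfl : j = t + 1 := by omega
          have : t / 2 + 2 + (1 - (w₁ t).length % 2) = (t + 1) / 2 + 2 := by omega
          rw [this] at m₁ m₂
          exact ⟨m₁, m₂⟩
        · exact ih j c
      · right
        exact ⟨[b], _, _, _, hb₁, hb₂, by omega, l.1, l.2, by omega, .inr ⟨by simp, by omega⟩⟩
    · exact .inr (ih.step hd e₁ e₂ hc)

/-- Dropping the last two steps of a critical PSW in `G_d` yields a PSW in
`G_{d−1}`. -/
theorem criticalPSW_prefix (d k : ℕ) (hd : 3 ≤ d) (w₁ w₂ : ℕ → List Nd)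
    (h : IsCriticalPSW d k w₁ w₂) :
    IsPSW (d - 1) (k - 2) w₁ w₂ := by
  obtain ⟨⟨hw, hs⟩, -⟩ := h
  have hs : Sep d (w₁ k) (w₂ k) := hs
  have hd2 : 2 ≤ d := by omega
  have hk := hw.klen
  have hL := PCW.len hd2 hw
  have hLk := hL k le_rfl
  have noLate : ¬ Late k (w₁ k) (w₂ k) := fun hl =>
    hl.not_sep hd2 hk hLk.1 hLk.2.1 (by omega) (by omega) hs
  have hT : Tight k w₁ w₂ := (PCW.inv hd2 hw k le_rfl).resolve_right noLate
  have hk' : k = 2 * d - 3 := by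
    have hs' := (sep_iff' hd2 hLk.1 hLk.2.1 (by omega) (by omega) (by omega)).1 hs
    have := headI_le (hT k le_rfl).1
    have := headI_le (hT k le_rfl).2
    omega
  have hV : ∀ j ≤ k - 2, Vd (d - 1) (w₁ j) ∧ Vd (d - 1) (w₂ j) := by
    intro j hj
    have a := hL j (by omega)
    have b := hT j (by omega)
    exact ⟨a.1.of_lab (by omega) (b.1.mono (by omega)) (by omega),
      a.2.1.of_lab (by omega) (b.2.mono (by omega)) (by omega)⟩
  refine ⟨⟨by omega, fun j hj => ?_, fun j hj => ?_, hw.start₁, hw.start₂,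
    fun j h1 h2 => hw.compat j h1 (by omega)⟩, ?_⟩
  · exact ⟨(hV j (by omega)).1, (hV (j + 1) (by omega)).1, (hw.walk₁ j (by omega)).2.2⟩
  · exact ⟨(hV j (by omega)).2, (hV (j + 1) (by omega)).2, (hw.walk₂ j (by omega)).2.2⟩
  · change Sep (d - 1) _ _
    have a := hL (k - 2) (by omega)
    have b := hT (k - 2) (by omega)
    have v := hV (k - 2) le_rfl
    rw [sep_iff' (by omega) v.1 v.2 (by omega) (by omega) (by omega)]
    refine ⟨by omega, fun ha => noLate ?_⟩
    obtain ⟨m, rfl⟩ : ∃ m, k = m + 2 := ⟨k - 2, by omega⟩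
    simp only [Nat.add_sub_cancel] at *
    have e₁ := hw.walk₁ m (by omega)
    have e₂ := hw.walk₂ m (by omega)
    have hc := hw.compat (m + 1) (by omega) (by omega)
    have hc' := hw.compat (m + 2) (by omega) (by omega)
    have b₁ : Lab (d - 1) (w₁ m) := b.1.mono (by omega)
    have b₂ : Lab (d - 1) (w₂ m) := b.2.mono (by omega)
    have hl : Late (m + 1) (w₁ (m + 1)) (w₂ (m + 1)) := by
      rcases step_agree hd2 (by omega) b₁ b₂ (by omega) (by omega) e₁ e₂ hc ha with
        ⟨m₁, m₂⟩ | ⟨b, hb₁, hb₂⟩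
      · have := hL (m + 1) (by omega)
        exact ⟨[], _, _, _, rfl, rfl, by omega, m₁, m₂, by omega, .inl (by omega)⟩
      · exact ⟨[b], _, _, _, hb₁, hb₂, by omega, b₁, b₂, by omega, .inr ⟨by simp, by omega⟩⟩
    exact hl.step hd2 (hw.walk₁ (m + 1) (by omega)) (hw.walk₂ (m + 1) (by omega)) hc'

end Paper
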